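/- Let λ ∈ (0,1), let t ≠ 0 and r₂ be real numbers with λ²t² ≤ r₂²(1−λ)². Define the real 3×4 matrices M₁ = (1/2)·[0-column | λt·I₃], M₂ = (1/2)·[[0, λt, 0, 0], [r₂(1−λ), 0, 0, 0], [0,0,0,0]], and M₃ = (1/2)·[(0, r₂(1−λ), 0)ᵀ-column | λt·I₃]. Then (min over rank-1 orthogonal projections P of ‖M₁ − PM₁‖₂²) + (min over rank-1 orthogonal projections P of ‖M₂ − PM₂‖₂²) = (3/4)λ²t², while min over rank-1 orthogonal projections P of ‖M₃ − PM₃‖₂² = (1/2)λ²t², and (3/4)λ²t² > (1/2)λ²t². In particular the total AB-quantum correlation strictly exceeds the total BA-quantum correlation for these states. -/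

import Mathlib

open Matrix

/-- The set of values `‖M - P * M‖₂²` as `P` ranges over real `3 × 3` orthogonal
projection matrices of rank 1. -/
def projDistSet (M : Matrix (Fin 3) (Fin 4) ℝ) : Set ℝ :=
  {x : ℝ | ∃ P : Matrix (Fin 3) (Fin 3) ℝ, Pᵀ = P ∧ P * P = P ∧ P.rank = 1 ∧
    x = ((M - P * M) * (M - P * M)ᵀ).trace}

/-- The `A`-correlation matrix of `ρ = λ ρ_BD + (1-λ) ρ_p` with `t₁ = t₂ = t₃ = t`,
`r₁ = r₃ = 0`: a zero column followed by `λt·I₃`, times `1/2`. -/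
noncomputable def MA (l t : ℝ) : Matrix (Fin 3) (Fin 4) ℝ :=
  (1 / 2 : ℝ) • !![0, l * t, 0, 0; 0, 0, l * t, 0; 0, 0, 0, l * t]

/-- The `B`-correlation matrix of the state after the optimal `A`-projection. -/
noncomputable def MBpost (l t r₂ : ℝ) : Matrix (Fin 3) (Fin 4) ℝ :=
  (1 / 2 : ℝ) • !![0, l * t, 0, 0; r₂ * (1 - l), 0, 0, 0; 0, 0, 0, 0]

/-- The `B`-correlation matrix of `ρ` itself. -/
noncomputable def MB (l t r₂ : ℝ) : Matrix (Fin 3) (Fin 4) ℝ :=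
  (1 / 2 : ℝ) • !![0, l * t, 0, 0; r₂ * (1 - l), 0, l * t, 0; 0, 0, 0, l * t]

/-- Over a field, the trace of an idempotent matrix is its rank. -/
theorem Matrix.trace_eq_rank_of_isIdempotentElem {n K : Type*} [Fintype n] [DecidableEq n]
    [Field K] {P : Matrix n n K} (hP : IsIdempotentElem P) : P.trace = P.rank := by
  have h : IsIdempotentElem (toLin' P) := by
    rw [IsIdempotentElem, Module.End.mul_eq_comp, ← toLin'_mul, hP.eq]
  rw [← trace_toLin'_eq, (LinearMap.IsIdempotentElem.isProj_range _ h).trace]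
  rfl

/-- A diagonal entry of an orthogonal projection matrix is nonnegative. -/
theorem Matrix.diag_nonneg_of_transpose_eq_of_mul_self_eq {n : Type*} [Fintype n]
    {P : Matrix n n ℝ} (hT : Pᵀ = P) (hP : P * P = P) (i : n) : 0 ≤ P i i := by
  have h : P i i = ∑ j, P i j * P i j := by
    conv_lhs => rw [← hP, mul_apply]
    exact Finset.sum_congr rfl fun j _ ↦ by rw [← congrFun₂ hT i j, transpose_apply]
  rw [h]
  exact Finset.sum_nonneg fun j _ ↦ mul_self_nonneg _

/-- The squared Frobenius norm of `M - P * M` for an orthogonal projection `P`. -/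
theorem Matrix.trace_sub_mul_mul_transpose {m n : Type*} [Fintype m] [Fintype n]
    {P : Matrix n n ℝ} (hT : Pᵀ = P) (hP : P * P = P) (M : Matrix n m ℝ) :
    ((M - P * M) * (M - P * M)ᵀ).trace = (M * Mᵀ).trace - (P * (M * Mᵀ)).trace := by
  have h₁ : (M * Mᵀ * P).trace = (P * (M * Mᵀ)).trace := trace_mul_comm _ _
  have h₂ : (P * (M * Mᵀ) * P).trace = (P * (M * Mᵀ)).trace := by
    rw [trace_mul_comm, ← Matrix.mul_assoc, hP]
  have h : (M - P * M) * (M - P * M)ᵀ =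
      M * Mᵀ - P * (M * Mᵀ) - (M * Mᵀ * P - P * (M * Mᵀ) * P) := by
    rw [transpose_sub, transpose_mul, hT]
    simp only [Matrix.sub_mul, Matrix.mul_sub, Matrix.mul_assoc]
  rw [h, trace_sub, trace_sub, trace_sub, h₁, h₂]
  ring

/-- If `M * Mᵀ` is diagonal with largest entry `d i`, then the squared distance from `M` to
`P * M`, over rank-one orthogonal projections `P`, is least for the `i`-th coordinate projection. -/
theorem isLeast_projDistSet {M : Matrix (Fin 3) (Fin 4) ℝ} {d : Fin 3 → ℝ}
    (hM : M * Mᵀ = diagonal d) {i : Fin 3} (hi : ∀ j, d j ≤ d i) :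
    IsLeast (projDistSet M) (∑ j, d j - d i) := by
  constructor
  · have hT : (single i i (1 : ℝ))ᵀ = single i i 1 := transpose_single ..
    have hP : single i i (1 : ℝ) * single i i 1 = single i i 1 := by simp
    have htr := trace_eq_rank_of_isIdempotentElem (P := single i i (1 : ℝ)) hP
    refine ⟨single i i 1, hT, hP, ?_, ?_⟩
    · rw [trace_single_eq_same] at htr
      exact_mod_cast htr.symm
    · rw [trace_sub_mul_mul_transpose hT hP, hM, trace_diagonal]
      simp [trace, mul_diagonal, single_apply]
  · rintro _ ⟨P, hT, hP, hr, rfl⟩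
    have htr : ∑ j, P j j = 1 := by
      simpa [hr, trace] using trace_eq_rank_of_isIdempotentElem (P := P) hP
    rw [trace_sub_mul_mul_transpose hT hP, hM, trace_diagonal]
    refine sub_le_sub_left ?_ _
    calc (P * diagonal d).trace = ∑ j, P j j * d j := by simp [trace, mul_diagonal]
      _ ≤ ∑ j, P j j * d i := Finset.sum_le_sum fun j _ ↦
          mul_le_mul_of_nonneg_left (hi j) (diag_nonneg_of_transpose_eq_of_mul_self_eq hT hP j)
      _ = d i := by rw [← Finset.sum_mul, htr, one_mul]

theorem MA_mul_transpose (l t : ℝ) :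
    MA l t * (MA l t)ᵀ = diagonal ![(l * t) ^ 2 / 4, (l * t) ^ 2 / 4, (l * t) ^ 2 / 4] := by
  ext i j
  fin_cases i <;> fin_cases j <;> simp [MA, mul_apply, Fin.sum_univ_four] <;> ring

theorem MBpost_mul_transpose (l t r₂ : ℝ) :
    MBpost l t r₂ * (MBpost l t r₂)ᵀ =
      diagonal ![(l * t) ^ 2 / 4, (r₂ * (1 - l)) ^ 2 / 4, 0] := by
  ext i j
  fin_cases i <;> fin_cases j <;> simp [MBpost, mul_apply, Fin.sum_univ_four] <;> ring

theorem MB_mul_transpose (l t r₂ : ℝ) :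
    MB l t r₂ * (MB l t r₂)ᵀ =
      diagonal ![(l * t) ^ 2 / 4, ((r₂ * (1 - l)) ^ 2 + (l * t) ^ 2) / 4, (l * t) ^ 2 / 4] := by
  ext i j
  fin_cases i <;> fin_cases j <;> simp [MB, mul_apply, Fin.sum_univ_four] <;> ring

/-- For `λ ∈ (0,1)`, `t ≠ 0` and `λ²t² ≤ r₂²(1-λ)²`, the total `AB`-quantum correlation
`Q_AB = (3/4)λ²t²` strictly exceeds the total `BA`-quantum correlation
`Q_BA = (1/2)λ²t²`: the total quantum correlation is not symmetric in the order
of the subsystems. -/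
theorem qab_ne_qba (l t r₂ : ℝ) (hl0 : 0 < l) (hl1 : l < 1) (ht : t ≠ 0)
    (hmin : l ^ 2 * t ^ 2 ≤ r₂ ^ 2 * (1 - l) ^ 2) :
    ∃ q₁ q₂ : ℝ, IsLeast (projDistSet (MA l t)) q₁ ∧
      IsLeast (projDistSet (MBpost l t r₂)) q₂ ∧
      q₁ + q₂ = 3 / 4 * l ^ 2 * t ^ 2 ∧
      IsLeast (projDistSet (MB l t r₂)) (1 / 2 * l ^ 2 * t ^ 2) ∧
      1 / 2 * l ^ 2 * t ^ 2 < 3 / 4 * l ^ 2 * t ^ 2 := by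
  have hpos : 0 < l ^ 2 * t ^ 2 := by positivity
  have hnn : 0 ≤ (r₂ * (1 - l)) ^ 2 := sq_nonneg _
  refine ⟨_, _, isLeast_projDistSet (MA_mul_transpose l t) (i := 1) ?_,
    isLeast_projDistSet (MBpost_mul_transpose l t r₂) (i := 1) ?_, ?_, ?_, by linarith⟩
  · intro j
    fin_cases j <;> simp
  · intro j
    fin_cases j <;> simp <;> nlinarith
  · simp [Fin.sum_univ_three]
    ring
  · convert isLeast_projDistSet (MB_mul_transpose l t r₂) (i := 1) ?_ using 1
    · simp [Fin.sum_univ_three]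
      ring
    · intro j
      fin_cases j <;> simp <;> nlinarith
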